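/- arXiv:math/0503361 — 3 statements merged into one kernel-verified Lean document; each statement's English description precedes it below -/
import Mathlib

section
/- (Krasovskii) Let g : ℝ^n → ℝ^n be continuously differentiable with g(0) = 0, and let J(x) denote the Jacobian matrix of g at x. If there exists a constant positive definite symmetric n×n matrix P such that the function x ↦ xᵀ [P J(x) + J(x)ᵀ P] x is negative definite (i.e. it is 0 at x = 0 and strictly negative for all x ≠ 0), then the zero solution of x'(t) = g(x) is globally asymptotically stable: it is stable, and every solution x(t) of x'(t) = g(x(t)) defined on [t₀, ∞) satisfies x(t) → 0 as t → ∞. -/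
open Filter Topology Set

theorem kras_abs {E : Type*} [NormedAddCommGroup E] [InnerProductSpace ℝ E]
    [FiniteDimensional ℝ E] (g : E → E) (hg : ContDiff ℝ 1 g) (hg0 : g 0 = 0)
    (T : E →L[ℝ] E) (hT : ∀ x y, inner ℝ (T x) y = inner ℝ x (T y))
    (hpos : ∀ x, x ≠ 0 → 0 < inner ℝ (T x) x)
    (hneg : ∀ x, x ≠ 0 → inner ℝ (T x) (fderiv ℝ g x x) < 0) :
    (∀ ε > 0, ∃ δ > 0, ∀ (x : ℝ → E) (t₀ : ℝ),
      (∀ t ∈ Set.Ici t₀, HasDerivAt x (g (x t)) t) →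
      ‖x t₀‖ < δ → ∀ t ∈ Set.Ici t₀, ‖x t‖ < ε)
    ∧ ∀ (x : ℝ → E) (t₀ : ℝ),
        (∀ t ∈ Set.Ici t₀, HasDerivAt x (g (x t)) t) →
        Filter.Tendsto x Filter.atTop (nhds 0) := by
  have hgc : Continuous g := hg.continuous
  have hgd : Differentiable ℝ g := hg.differentiable (by norm_num)
  have hVc : Continuous (fun x : E => inner ℝ (T x) x) := by fun_prop
  have hWc : Continuous (fun x : E => inner ℝ (T x) (g x)) := by fun_prop
  -- the derivative along the field is negative
  have hW : ∀ x, x ≠ 0 → inner ℝ (T x) (g x) < 0 := by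
    intro x hx
    have hd : ∀ s : ℝ, HasDerivAt (fun s : ℝ => inner ℝ (T x) (g (s • x)))
        (inner ℝ (T x) (fderiv ℝ g (s • x) x)) s := by
      intro s
      have h1 : HasDerivAt (fun s : ℝ => s • x) x s := by
        simpa using (hasDerivAt_id s).smul_const x
      have h2 := (hgd (s • x)).hasFDerivAt.comp_hasDerivAt s h1
      simpa using (hasDerivAt_const s (T x)).inner ℝ h2
    obtain ⟨s, hs, he⟩ := exists_hasDerivAt_eq_slope
      (fun s : ℝ => inner ℝ (T x) (g (s • x))) _ (zero_lt_one)
      (fun s _ => (hd s).continuousAt.continuousWithinAt) (fun s _ => hd s)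
    have hs0 : 0 < s := hs.1
    have h3 := hneg (s • x) (smul_ne_zero hs0.ne' hx)
    simp only [map_smul, inner_smul_left, inner_smul_right] at h3
    simp [hg0] at he h3
    rw [← he]
    by_contra hc
    push Not at hc
    have := mul_nonneg hs0.le (mul_nonneg hs0.le hc)
    linarith
  obtain ⟨c, hc, hcV⟩ : ∃ c : ℝ, 0 < c ∧ ∀ x : E, c * ‖x‖ ^ 2 ≤ inner ℝ (T x) x := by
    obtain ⟨c, hc, h⟩ := (isCompact_sphere (0 : E) 1).exists_forall_le' (a := (0 : ℝ))
      hVc.continuousOn (fun x hx => hpos x (by rintro rfl; simp at hx))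
    refine ⟨c, hc, fun x => ?_⟩
    by_cases hx : x = 0
    · simp [hx]
    have hn : 0 < ‖x‖ := norm_pos_iff.2 hx
    have := h (‖x‖⁻¹ • x) (by simp [norm_smul, hn.ne'])
    simp only [map_smul, inner_smul_left, inner_smul_right] at this
    simp at this
    calc c * ‖x‖ ^ 2 ≤ (‖x‖⁻¹ * (‖x‖⁻¹ * inner ℝ (T x) x)) * ‖x‖ ^ 2 := by gcongr
      _ = _ := by field_simp
  have hV' : ∀ (x : ℝ → E) (t : ℝ), HasDerivAt x (g (x t)) t →
      HasDerivAt (fun t => inner ℝ (T (x t)) (x t)) (2 * inner ℝ (T (x t)) (g (x t))) t := by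
    intro x t h
    have h1 := T.hasFDerivAt.comp_hasDerivAt t h
    have h2 : HasDerivAt (fun t => inner ℝ (T (x t)) (x t))
        (inner ℝ (T (x t)) (g (x t)) + inner ℝ (T (g (x t))) (x t)) t := h1.inner ℝ h
    have h3 : inner ℝ (T (x t)) (g (x t)) + inner ℝ (T (g (x t))) (x t)
        = 2 * inner ℝ (T (x t)) (g (x t)) := by
      rw [hT (g (x t)), real_inner_comm (T (x t)) (g (x t))]
      ring
    rw [h3] at h2
    exact h2
  have hWle : ∀ x, inner ℝ (T x) (g x) ≤ 0 := by
    intro x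
    by_cases hx : x = 0
    · simp [hx]
    · exact (hW x hx).le
  have hanti : ∀ (x : ℝ → E) (t₀ : ℝ), (∀ t ∈ Set.Ici t₀, HasDerivAt x (g (x t)) t) →
      AntitoneOn (fun t => inner ℝ (T (x t)) (x t)) (Ici t₀) := by
    intro x t₀ h
    refine antitoneOn_of_hasDerivWithinAt_nonpos (convex_Ici t₀)
      (f' := fun t => 2 * inner ℝ (T (x t)) (g (x t)))
      (fun t ht => (hV' x t (h t ht)).continuousAt.continuousWithinAt)
      (fun t ht => (hV' x t (h t (interior_subset ht))).hasDerivWithinAt) ?_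
    intro t _
    linarith [hWle (x t)]
  constructor
  · intro ε hε
    have h0 : ∀ᶠ y in 𝓝 (0 : E), inner ℝ (T y) y < c * ε ^ 2 := by
      apply hVc.continuousAt.eventually_lt_const
      simp; positivity
    obtain ⟨δ, hδ, hb⟩ := Metric.eventually_nhds_iff.1 h0
    refine ⟨δ, hδ, fun x t₀ h hx t ht => ?_⟩
    have h1 := hb (y := x t₀) (by simpa using hx)
    have h2 : inner ℝ (T (x t)) (x t) ≤ inner ℝ (T (x t₀)) (x t₀) :=
      hanti x t₀ h (mem_Ici.2 le_rfl) ht ht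
    have h3 := hcV (x t)
    have h4 : ‖x t‖ ^ 2 < ε ^ 2 := lt_of_mul_lt_mul_left (by linarith) hc.le
    exact lt_of_pow_lt_pow_left₀ 2 hε.le h4
  · intro x t₀ h
    rw [Metric.tendsto_atTop]
    intro ε hε
    by_contra hcon
    push Not at hcon
    have hη : ∀ t ∈ Ici t₀, c * ε ^ 2 ≤ inner ℝ (T (x t)) (x t) := by
      intro t ht
      obtain ⟨s, hs, hxs⟩ := hcon t
      have h2 : inner ℝ (T (x s)) (x s) ≤ inner ℝ (T (x t)) (x t) :=
        hanti x t₀ h ht (le_trans (mem_Ici.1 ht) hs) hs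
      refine le_trans ?_ ((hcV (x s)).trans h2)
      rw [dist_zero_right] at hxs
      gcongr
    set V0 : ℝ := inner ℝ (T (x t₀)) (x t₀) with hV0
    let K : Set E := {y | c * ε ^ 2 ≤ inner ℝ (T y) y} ∩ {y | inner ℝ (T y) y ≤ V0}
    have hKc : IsClosed K :=
      (isClosed_le continuous_const hVc).inter (isClosed_le hVc continuous_const)
    have hK : IsCompact K := by
      refine (isCompact_closedBall (0 : E) (√(V0 / c))).of_isClosed_subset hKc ?_
      intro y hy
      rw [mem_closedBall_zero_iff]
      apply Real.le_sqrt_of_sq_le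
      rw [le_div_iff₀ hc]
      have h1 := hcV y
      have h2 : inner ℝ (T y) y ≤ V0 := hy.2
      linarith
    obtain ⟨m, hm, hmK⟩ := hK.exists_forall_le' (a := (0 : ℝ))
      (f := fun y => - inner ℝ (T y) (g y)) hWc.neg.continuousOn (by
        intro y hy
        have h1 : c * ε ^ 2 ≤ inner ℝ (T y) y := hy.1
        have : y ≠ 0 := by
          rintro rfl
          simp at h1
          have : 0 < c * ε ^ 2 := by positivity
          linarith
        linarith [hW y this])
    have hxK : ∀ t ∈ Ici t₀, x t ∈ K := fun t ht =>
      ⟨hη t ht, hanti x t₀ h (mem_Ici.2 le_rfl) ht ht⟩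
    have hanti2 : AntitoneOn (fun t => inner ℝ (T (x t)) (x t) + m * t) (Ici t₀) := by
      have hd : ∀ t ∈ Ici t₀, HasDerivAt (fun t => inner ℝ (T (x t)) (x t) + m * t)
          (2 * inner ℝ (T (x t)) (g (x t)) + m * 1) t := fun t ht =>
        (hV' x t (h t ht)).add ((hasDerivAt_id t).const_mul m)
      refine antitoneOn_of_hasDerivWithinAt_nonpos (convex_Ici t₀)
        (f' := fun t => 2 * inner ℝ (T (x t)) (g (x t)) + m * 1)
        (fun t ht => (hd t ht).continuousAt.continuousWithinAt)
        (fun t ht => (hd t (interior_subset ht)).hasDerivWithinAt) ?_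
      intro t ht
      have := hmK (x t) (hxK t (interior_subset ht))
      linarith
    have hV0p : 0 ≤ V0 := le_trans (by positivity) (hη t₀ (mem_Ici.2 le_rfl))
    have ht1 : t₀ ≤ t₀ + V0 / m := by
      have : 0 ≤ V0 / m := by positivity
      linarith
    have h5 := hanti2 (mem_Ici.2 le_rfl) (mem_Ici.2 ht1) ht1
    have h6 := hη _ (mem_Ici.2 ht1)
    have h7 : 0 < c * ε ^ 2 := by positivity
    have h8 : m * (t₀ + V0 / m) = m * t₀ + V0 := by field_simp
    simp only [h8, ← hV0] at h5
    linarith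


/-- Krasovskii: If `g` is C¹ with `g 0 = 0`, `J(x)` is its
Jacobian, and there is a constant symmetric positive definite matrix `P` such
that `x ↦ xᵀ [P J(x) + J(x)ᵀ P] x` is negative definite, then the zero solution
of `x' = g(x)` is globally asymptotically stable. -/
theorem statement6 {n : ℕ}
    (g : EuclideanSpace ℝ (Fin n) → EuclideanSpace ℝ (Fin n))
    (hg : ContDiff ℝ 1 g) (hg0 : g 0 = 0)
    (J : EuclideanSpace ℝ (Fin n) → Matrix (Fin n) (Fin n) ℝ)
    (hJ : ∀ x i j, J x i j = fderiv ℝ g x (EuclideanSpace.single j 1) i)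
    (P : Matrix (Fin n) (Fin n) ℝ) (hPsymm : P.IsSymm)
    (hPpos : ∀ x : EuclideanSpace ℝ (Fin n), x ≠ 0 →
      0 < ∑ i, ∑ j, x i * P i j * x j)
    (hneg : ∀ x : EuclideanSpace ℝ (Fin n), x ≠ 0 →
      ∑ i, ∑ j, x i * ((P * J x + (J x).transpose * P) i j) * x j < 0) :
    (∀ ε > 0, ∃ δ > 0, ∀ (x : ℝ → EuclideanSpace ℝ (Fin n)) (t₀ : ℝ),
      (∀ t ∈ Set.Ici t₀, HasDerivAt x (g (x t)) t) →
      ‖x t₀‖ < δ → ∀ t ∈ Set.Ici t₀, ‖x t‖ < ε)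
    ∧ ∀ (x : ℝ → EuclideanSpace ℝ (Fin n)) (t₀ : ℝ),
        (∀ t ∈ Set.Ici t₀, HasDerivAt x (g (x t)) t) →
        Filter.Tendsto x Filter.atTop (nhds 0) := by
  have hq : ∀ (M : Matrix (Fin n) (Fin n) ℝ) (x : EuclideanSpace ℝ (Fin n)),
      ∑ i, ∑ j, x i * M i j * x j = x.ofLp ⬝ᵥ M.mulVec x.ofLp := by
    intro M x
    simp only [dotProduct, Matrix.mulVec, Finset.mul_sum, mul_assoc]
  have hT1 : ∀ x y : EuclideanSpace ℝ (Fin n),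
      inner ℝ (Matrix.toEuclideanCLM (𝕜 := ℝ) P x) y = y.ofLp ⬝ᵥ P.mulVec x.ofLp := by
    intro x y
    simp [EuclideanSpace.inner_eq_star_dotProduct]
  have hsw : ∀ u v : Fin n → ℝ, u ⬝ᵥ P.mulVec v = v ⬝ᵥ P.mulVec u := by
    intro u v
    rw [Matrix.dotProduct_mulVec, ← Matrix.mulVec_transpose, hPsymm.eq, dotProduct_comm]
  have hJx : ∀ x : EuclideanSpace ℝ (Fin n),
      (J x).mulVec x.ofLp = (fderiv ℝ g x x).ofLp := by
    intro x
    ext i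
    have hx : x = ∑ j, x j • EuclideanSpace.single j (1 : ℝ) := by
      ext k
      simp [Pi.single_apply]
    conv_rhs => rw [show fderiv ℝ g x x = fderiv ℝ g x (∑ j, x j • EuclideanSpace.single j (1 : ℝ)) from congrArg _ hx]
    simp [Matrix.mulVec, dotProduct, hJ, mul_comm]
  refine kras_abs g hg hg0 (Matrix.toEuclideanCLM (𝕜 := ℝ) P) ?_ ?_ ?_
  · intro x y
    rw [real_inner_comm _ x, hT1, hT1, hsw]
  · intro x hx
    rw [hT1, ← hq]
    exact hPpos x hx
  · intro x hx
    have h := hneg x hx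
    rw [hq, Matrix.add_mulVec, dotProduct_add, ← Matrix.mulVec_mulVec, ← Matrix.mulVec_mulVec,
      hJx, hsw, Matrix.dotProduct_mulVec x.ofLp (J x).transpose, Matrix.vecMul_transpose,
      hJx] at h
    rw [hT1]
    linarith
end

section
/- Consider the planar autonomous system x₁'(t) = −4x₁ + x₁·sech(x₁) + 4x₂, x₂'(t) = −x₁ − 6x₂ − x₂·cos(x₂), where sech(u) = 1/cosh(u). The zero solution is globally asymptotically stable: it is stable, and every solution x(t) defined on [t₀, ∞) satisfies x(t) → (0,0) as t → ∞. -/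
/-- Exponential decay of the squared norm along solutions. -/
lemma key_decay (x : ℝ → EuclideanSpace ℝ (Fin 2)) (t₀ : ℝ)
    (h : ∀ t ∈ Set.Ici t₀,
        HasDerivAt (fun s => x s 0)
          (-4 * x t 0 + x t 0 * (1 / Real.cosh (x t 0)) + 4 * x t 1) t ∧
        HasDerivAt (fun s => x s 1)
          (-(x t 0) - 6 * x t 1 - x t 1 * Real.cos (x t 1)) t) :
    ∀ t ∈ Set.Ici t₀, ‖x t‖ ≤ Real.exp (-(t - t₀)) * ‖x t₀‖ := by
  have hn : ∀ t, ‖x t‖ ^ 2 = x t 0 ^ 2 + x t 1 ^ 2 := by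
    intro t
    simp [EuclideanSpace.norm_sq_eq, Fin.sum_univ_two]
  let W : ℝ → ℝ := fun s => Real.exp (2 * s) * (x s 0 ^ 2 + x s 1 ^ 2)
  have hW : ∀ t ∈ Set.Ici t₀, HasDerivAt W
      (Real.exp (2 * t) * 2 * (x t 0 ^ 2 + x t 1 ^ 2) + Real.exp (2 * t) *
        (2 * x t 0 * (-4 * x t 0 + x t 0 * (1 / Real.cosh (x t 0)) + 4 * x t 1)
        + 2 * x t 1 * (-(x t 0) - 6 * x t 1 - x t 1 * Real.cos (x t 1)))) t := by
    intro t ht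
    obtain ⟨h0, h1⟩ := h t ht
    have he : HasDerivAt (fun s : ℝ => Real.exp (2 * s)) (Real.exp (2 * t) * 2) t := by
      simpa using ((hasDerivAt_id t).const_mul 2).exp
    have := he.mul ((h0.pow 2).add (h1.pow 2))
    refine this.congr_deriv ?_
    simp
  have hanti : AntitoneOn W (Set.Ici t₀) := by
    refine antitoneOn_of_deriv_nonpos (convex_Ici t₀)
      (fun t ht => (hW t ht).continuousAt.continuousWithinAt)
      (fun t ht => (hW t (interior_subset ht)).differentiableAt.differentiableWithinAt) ?_
    intro t ht
    rw [(hW t (interior_subset ht)).deriv]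
    have hs : 1 / Real.cosh (x t 0) ≤ 1 := by
      rw [div_le_one (Real.cosh_pos _)]
      exact Real.one_le_cosh _
    have hc := Real.neg_one_le_cos (x t 1)
    generalize 1 / Real.cosh (x t 0) = s at *
    generalize Real.cos (x t 1) = c at *
    generalize x t 0 = a at *
    generalize x t 1 = b at *
    have e := Real.exp_pos (2 * t)
    have k : 2 * (a ^ 2 + b ^ 2) + (2 * a * (-4 * a + a * s + 4 * b)
        + 2 * b * (-a - 6 * b - b * c)) ≤ 0 := by
      nlinarith [mul_nonneg (sq_nonneg a) (sub_nonneg.2 hs),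
        mul_nonneg (sq_nonneg b) (sub_nonneg.2 hc), sq_nonneg (a - b), sq_nonneg a, sq_nonneg b]
    nlinarith [mul_nonneg e.le (neg_nonneg.2 k)]
  intro t ht
  have hle : W t ≤ W t₀ := hanti Set.self_mem_Ici ht ht
  simp only [W, ← hn] at hle
  have e1 : ∀ s : ℝ, Real.exp (2 * s) = Real.exp s ^ 2 := by
    intro s
    rw [two_mul, Real.exp_add, sq]
  rw [e1, e1, ← mul_pow, ← mul_pow] at hle
  have h2 : Real.exp t * ‖x t‖ ≤ Real.exp t₀ * ‖x t₀‖ :=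
    (sq_le_sq₀ (by positivity) (by positivity)).1 hle
  have h3 : Real.exp (-(t - t₀)) = Real.exp t₀ / Real.exp t := by
    rw [← Real.exp_sub]; ring_nf
  rw [h3, div_mul_eq_mul_div, le_div_iff₀ (Real.exp_pos t)]
  linarith

/-- The zero solution of the planar system
`x₁' = −4x₁ + x₁·sech(x₁) + 4x₂`, `x₂' = −x₁ − 6x₂ − x₂·cos(x₂)`
(with `sech u = 1 / cosh u`) is globally asymptotically stable: it is stable,
and every solution defined on `[t₀, ∞)` converges to the origin. -/
theorem statement10 :
    (∀ ε > 0, ∃ δ > 0, ∀ (x : ℝ → EuclideanSpace ℝ (Fin 2)) (t₀ : ℝ),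
      (∀ t ∈ Set.Ici t₀,
        HasDerivAt (fun s => x s 0)
          (-4 * x t 0 + x t 0 * (1 / Real.cosh (x t 0)) + 4 * x t 1) t ∧
        HasDerivAt (fun s => x s 1)
          (-(x t 0) - 6 * x t 1 - x t 1 * Real.cos (x t 1)) t) →
      ‖x t₀‖ < δ → ∀ t ∈ Set.Ici t₀, ‖x t‖ < ε)
    ∧ ∀ (x : ℝ → EuclideanSpace ℝ (Fin 2)) (t₀ : ℝ),
        (∀ t ∈ Set.Ici t₀,
          HasDerivAt (fun s => x s 0)
            (-4 * x t 0 + x t 0 * (1 / Real.cosh (x t 0)) + 4 * x t 1) t ∧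
          HasDerivAt (fun s => x s 1)
            (-(x t 0) - 6 * x t 1 - x t 1 * Real.cos (x t 1)) t) →
        Filter.Tendsto x Filter.atTop (nhds 0) := by
  constructor
  · intro ε hε
    refine ⟨ε, hε, fun x t₀ h h0 t ht => ?_⟩
    have h1 := key_decay x t₀ h t ht
    have h2 : Real.exp (-(t - t₀)) ≤ 1 :=
      Real.exp_le_one_iff.2 (by simpa using ht)
    nlinarith [norm_nonneg (x t₀)]
  · intro x t₀ h
    rw [tendsto_zero_iff_norm_tendsto_zero]
    have hlim : Filter.Tendsto (fun t => Real.exp (-(t - t₀)) * ‖x t₀‖) Filter.atTop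
        (nhds 0) := by
      have h1 : Filter.Tendsto (fun t : ℝ => t - t₀) Filter.atTop Filter.atTop :=
        Filter.tendsto_atTop_add_const_right _ (-t₀) Filter.tendsto_id
      simpa using (Real.tendsto_exp_neg_atTop_nhds_zero.comp h1).mul_const ‖x t₀‖
    refine squeeze_zero' (Filter.Eventually.of_forall fun t => norm_nonneg _) ?_ hlim
    filter_upwards [Filter.eventually_ge_atTop t₀] with t ht
    exact key_decay x t₀ h t ht
end

section
/- Consider the two-neuron Hopfield-Tank system on ℝ²: x₁'(t) = −13x₁ + x₂ − tanh(3x₁), x₂'(t) = x₁ − 11x₂ + (1/5)tanh(3x₂). The zero solution is globally asymptotically stable: it is stable (for every ε > 0 there is δ > 0 such that every solution with ‖x(t₀)‖ < δ satisfies ‖x(t)‖ < ε for all t ≥ t₀), and every solution x(t) defined on [t₀, ∞) satisfies x(t) → (0,0) as t → ∞. -/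
theorem ht_sinh_le (y : ℝ) (hy : 0 ≤ y) : Real.sinh y ≤ y * Real.cosh y := by
  have hd : ∀ z : ℝ, HasDerivAt (fun z => z * Real.cosh z - Real.sinh z) (z * Real.sinh z) z := by
    intro z
    have h := ((hasDerivAt_id z).mul (Real.hasDerivAt_cosh z)).sub (Real.hasDerivAt_sinh z)
    refine h.congr_deriv ?_
    simp
  have hm : MonotoneOn (fun z => z * Real.cosh z - Real.sinh z) (Set.Ici (0:ℝ)) := by
    apply monotoneOn_of_deriv_nonneg (convex_Ici 0)
    · exact fun z _ => (hd z).continuousAt.continuousWithinAt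
    · exact fun z _ => (hd z).differentiableAt.differentiableWithinAt
    · intro z hz
      rw [interior_Ici] at hz
      rw [(hd z).deriv]
      exact mul_nonneg (le_of_lt hz) (Real.sinh_nonneg_iff.2 (le_of_lt hz))
  have := hm (Set.self_mem_Ici) (Set.mem_Ici.2 hy) hy
  simp at this
  linarith

theorem ht_tanh_bounds_nonneg (y : ℝ) (hy : 0 ≤ y) :
    0 ≤ y * Real.tanh y ∧ y * Real.tanh y ≤ y ^ 2 := by
  have hc := Real.cosh_pos y
  have h1 : 0 ≤ Real.tanh y := by
    rw [Real.tanh_eq_sinh_div_cosh]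
    exact div_nonneg (Real.sinh_nonneg_iff.2 hy) hc.le
  have h2 : Real.tanh y ≤ y := by
    rw [Real.tanh_eq_sinh_div_cosh, div_le_iff₀ hc]
    exact ht_sinh_le y hy
  exact ⟨mul_nonneg hy h1, by nlinarith⟩

theorem ht_tanh_bounds (y : ℝ) : 0 ≤ y * Real.tanh y ∧ y * Real.tanh y ≤ y ^ 2 := by
  rcases le_total 0 y with hy | hy
  · exact ht_tanh_bounds_nonneg y hy
  · have := ht_tanh_bounds_nonneg (-y) (by linarith)
    simpa [Real.tanh_neg] using this

theorem ht_decay (x : ℝ → EuclideanSpace ℝ (Fin 2)) (t₀ : ℝ)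
    (h : ∀ t ∈ Set.Ici t₀,
        HasDerivAt (fun s => x s 0)
          (-13 * x t 0 + x t 1 - Real.tanh (3 * x t 0)) t ∧
        HasDerivAt (fun s => x s 1)
          (x t 0 - 11 * x t 1 + (1/5) * Real.tanh (3 * x t 1)) t) :
    ∀ t ∈ Set.Ici t₀, ‖x t‖ ≤ Real.exp (-(t - t₀)) * ‖x t₀‖ := by
  have hn : ∀ t, ‖x t‖ ^ 2 = x t 0 ^ 2 + x t 1 ^ 2 := by
    intro t
    rw [EuclideanSpace.norm_sq_eq]
    simp [Fin.sum_univ_two]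
  have hd : ∀ t ∈ Set.Ici t₀, ∃ d ≤ 0, HasDerivAt
      (fun s => Real.exp (2 * (s - t₀)) * (x s 0 ^ 2 + x s 1 ^ 2)) d t := by
    intro t ht
    obtain ⟨ha, hb⟩ := h t ht
    have he : HasDerivAt (fun s => Real.exp (2 * (s - t₀))) (Real.exp (2 * (t - t₀)) * (2 * 1)) t :=
      (((hasDerivAt_id t).sub_const t₀).const_mul 2).exp
    refine ⟨_, ?_, he.mul ((ha.pow 2).add (hb.pow 2))⟩
    have hp := Real.exp_pos (2 * (t - t₀))
    have h1 := (ht_tanh_bounds (3 * x t 0)).1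
    have h2 := (ht_tanh_bounds (3 * x t 1)).2
    simp only [Pi.add_apply, Pi.pow_apply]
    generalize Real.exp (2 * (t - t₀)) = e at *
    generalize Real.tanh (3 * x t 0) = p at *
    generalize Real.tanh (3 * x t 1) = q at *
    generalize x t 0 = a at *
    generalize x t 1 = b at *
    have key : 2 * (a ^ 2 + b ^ 2) + (2 * a * (-13 * a + b - p)
        + 2 * b * (a - 11 * b + (1/5) * q)) ≤ 0 := by
      nlinarith [sq_nonneg (a - b), sq_nonneg a, sq_nonneg b]
    have := mul_nonpos_of_nonneg_of_nonpos hp.le key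
    norm_num
    linarith
  have hm : AntitoneOn (fun s => Real.exp (2 * (s - t₀)) * (x s 0 ^ 2 + x s 1 ^ 2))
      (Set.Ici t₀) := by
    apply antitoneOn_of_deriv_nonpos (convex_Ici t₀)
    · intro t ht
      obtain ⟨d, _, hh⟩ := hd t ht
      exact hh.continuousAt.continuousWithinAt
    · intro t ht
      obtain ⟨d, _, hh⟩ := hd t (interior_subset ht)
      exact hh.differentiableAt.differentiableWithinAt
    · intro t ht
      obtain ⟨d, h0, hh⟩ := hd t (interior_subset ht)
      rw [hh.deriv]
      exact h0
  intro t ht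
  have h1 := hm (Set.self_mem_Ici) ht ht
  simp only [← hn, sub_self, mul_zero, Real.exp_zero, one_mul] at h1
  have h2 : Real.exp (2 * (t - t₀)) = Real.exp (t - t₀) ^ 2 := by
    rw [← Real.exp_nat_mul]
    norm_num
  rw [h2, ← mul_pow] at h1
  have h3 := le_trans (le_abs_self _) (abs_le_of_sq_le_sq h1 (norm_nonneg _))
  rw [Real.exp_neg, inv_mul_eq_div, le_div_iff₀ (Real.exp_pos _)]
  linarith

/-- The zero solution of the two-neuron Hopfield–Tank system
`x₁' = −13x₁ + x₂ − tanh(3x₁)`, `x₂' = x₁ − 11x₂ + (1/5)tanh(3x₂)` is globally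
asymptotically stable: it is stable, and every solution defined on `[t₀, ∞)`
converges to the origin as `t → ∞`. -/
theorem statement17 :
    (∀ ε > 0, ∃ δ > 0, ∀ (x : ℝ → EuclideanSpace ℝ (Fin 2)) (t₀ : ℝ),
      (∀ t ∈ Set.Ici t₀,
        HasDerivAt (fun s => x s 0)
          (-13 * x t 0 + x t 1 - Real.tanh (3 * x t 0)) t ∧
        HasDerivAt (fun s => x s 1)
          (x t 0 - 11 * x t 1 + (1/5) * Real.tanh (3 * x t 1)) t) →
      ‖x t₀‖ < δ → ∀ t ∈ Set.Ici t₀, ‖x t‖ < ε)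
    ∧ ∀ (x : ℝ → EuclideanSpace ℝ (Fin 2)) (t₀ : ℝ),
        (∀ t ∈ Set.Ici t₀,
          HasDerivAt (fun s => x s 0)
            (-13 * x t 0 + x t 1 - Real.tanh (3 * x t 0)) t ∧
          HasDerivAt (fun s => x s 1)
            (x t 0 - 11 * x t 1 + (1/5) * Real.tanh (3 * x t 1)) t) →
        Filter.Tendsto x Filter.atTop (nhds 0) := by
  constructor
  · intro ε hε
    refine ⟨ε, hε, fun x t₀ h h0 t ht => ?_⟩
    have h1 := ht_decay x t₀ h t ht
    have h2 : Real.exp (-(t - t₀)) ≤ 1 := by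
      rw [Real.exp_le_one_iff]
      have : t₀ ≤ t := ht
      linarith
    nlinarith [norm_nonneg (x t₀)]
  · intro x t₀ h
    have hlim : Filter.Tendsto (fun t => Real.exp (-(t - t₀)) * ‖x t₀‖) Filter.atTop (nhds 0) := by
      have h1 : Filter.Tendsto (fun t : ℝ => t - t₀) Filter.atTop Filter.atTop :=
        Filter.tendsto_atTop_add_const_right _ (-t₀) Filter.tendsto_id
      have h2 := (Real.tendsto_exp_neg_atTop_nhds_zero.comp h1).mul_const ‖x t₀‖
      simpa [Function.comp_def] using h2
    apply squeeze_zero_norm' _ hlim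
    filter_upwards [Filter.eventually_ge_atTop t₀] with t ht
    exact ht_decay x t₀ h t ht
end
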